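/- For any two one-counter nets N and N' with control-state sets Q and Q', the largest weak simulation relation ⪯w, viewed as a subset of Q×ℕ×Q'×ℕ, is a semilinear set: for every pair (q,q') ∈ Q×Q', the set {(n,n') ∈ ℕ² : qn ⪯w q'n'} is a finite union of linear sets. -/

import Mathlib

/-- A one-counter net over control states `Q` and actions `A`:
transitions carry a counter effect in `{-1, 0, 1}`. -/
structure OCN (Q A : Type) where
  δ : Q → A → ℤ → Q → Prop
  effect_bounded : ∀ p a d q, δ p a d q → d = -1 ∨ d = 0 ∨ d = 1

namespace OCN

/-- The step relation of the LTS induced by a one-counter net on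
configurations `Q × ℕ`:  `(p,m) →a (q,n)` iff there is a transition
`(p,a,d,q)` with `n = m + d ≥ 0`. -/
def Step {Q A : Type} (N : OCN Q A) (c : Q × ℕ) (a : A) (c' : Q × ℕ) : Prop :=
  ∃ d : ℤ, N.δ c.1 a d c'.1 ∧ (c'.2 : ℤ) = (c.2 : ℤ) + d

/-- An OCN is complete if every state has an `a`-labelled outgoing transition
for every action `a`. -/
def Complete {Q A : Type} (N : OCN Q A) : Prop :=
  ∀ p a, ∃ d q, N.δ p a d q

/-- An OCN is non-blocking if every state has an outgoing transition with
counter effect in `{0, 1}`. -/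
def NonBlocking {Q A : Type} (N : OCN Q A) : Prop :=
  ∀ p, ∃ a d q, N.δ p a d q ∧ (d = 0 ∨ d = 1)

end OCN

/-- `R` is a strong simulation between two labelled transition systems. -/
def IsSimulation {S S' A : Type} (stepL : S → A → S → Prop) (stepR : S' → A → S' → Prop)
    (R : S → S' → Prop) : Prop :=
  ∀ c c', R c c' → ∀ a d, stepL c a d → ∃ d', stepR c' a d' ∧ R d d'

/-- The strong simulation preorder `⪯`: the largest strong simulation,
i.e. the union of all strong simulations. -/
def Simulates {S S' A : Type} (stepL : S → A → S → Prop) (stepR : S' → A → S' → Prop)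
    (c : S) (c' : S') : Prop :=
  ∃ R, IsSimulation stepL stepR R ∧ R c c'

/-- Reachability via `τ`-labelled steps: `(→τ)*`. -/
def TauReach {S A : Type} (step : S → A → S → Prop) (τ : A) : S → S → Prop :=
  Relation.ReflTransGen (fun s t => step s τ t)

/-- Weak steps: `⇒τ = (→τ)*` and `⇒a = (→τ)* →a (→τ)*` for `a ≠ τ`. -/
def WeakStep {S A : Type} (step : S → A → S → Prop) (τ : A)
    (s : S) (a : A) (t : S) : Prop :=
  (a = τ ∧ TauReach step τ s t) ∨
  (∃ u v, TauReach step τ s u ∧ step u a v ∧ TauReach step τ v t)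

/-- `R` is a weak simulation: Spoiler moves along strong steps and
Duplicator responds with weak steps. -/
def IsWeakSimulation {S S' A : Type} (stepL : S → A → S → Prop)
    (stepR : S' → A → S' → Prop) (τ : A) (R : S → S' → Prop) : Prop :=
  ∀ c c', R c c' → ∀ a d, stepL c a d → ∃ d', WeakStep stepR τ c' a d' ∧ R d d'

/-- The weak simulation preorder `⪯w`: the largest weak simulation. -/
def WeakSimulates {S S' A : Type} (stepL : S → A → S → Prop)
    (stepR : S' → A → S' → Prop) (τ : A) (c : S) (c' : S') : Prop :=
  ∃ R, IsWeakSimulation stepL stepR τ R ∧ R c c'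

/-- A linear subset of `ℕ²`: a base `b` plus all `ℕ`-linear combinations of a
finite set of periods. -/
def IsLinearSubset (L : Set (ℕ × ℕ)) : Prop :=
  ∃ (b : ℕ × ℕ) (P : Finset (ℕ × ℕ)),
    L = {x | ∃ c : ℕ × ℕ → ℕ, x = b + ∑ p ∈ P, c p • p}

/-- A semilinear subset of `ℕ²`: a finite union of linear sets. -/
def IsSemilinearSubset (L : Set (ℕ × ℕ)) : Prop :=
  ∃ (n : ℕ) (f : Fin n → Set (ℕ × ℕ)),
    (∀ i, IsLinearSubset (f i)) ∧ L = ⋃ i, f i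



/-- The far region of the simulation game: states `V`, Spoiler moves `I`, frontier `f`. -/
structure Arena (V I : Type) where
  Mov : V → I → Prop
  dd : I → ℤ
  R : V → I → V → ℤ → Prop
  f : V → ℤ → ℤ
  L : ℤ
  K : ℤ
  n1 : ℤ
  hL : 1 ≤ L
  hK : 0 ≤ K
  hn1 : 0 ≤ n1
  hdd : ∀ v i, Mov v i → |dd i| ≤ 1
  hR : ∀ v i w c, R v i w c → |c| ≤ L
  low : ∀ v n, n1 ≤ n → K ≤ f v n
  step : ∀ v n m, n1 ≤ n → K ≤ m → f v n ≤ m → ∀ i, Mov v i →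
    ∃ w c, R v i w c ∧ f w (n + dd i) ≤ m + c
  coind : ∀ T : V → ℤ → ℤ → Prop,
    (∀ v n m, T v n m → n1 ≤ n ∧ K ≤ m ∧ ∀ i, Mov v i →
      ∃ w c, R v i w c ∧ (T w (n + dd i) (m + c) ∨ f w (n + dd i) ≤ m + c)) →
    ∀ v n m, T v n m → f v n ≤ m

namespace Arena

variable {V I : Type} (G : Arena V I)

theorem step_conv {v : V} {n m : ℤ} (hn : G.n1 ≤ n) (hm : G.K ≤ m)
    (h : ∀ i, G.Mov v i → ∃ w c, G.R v i w c ∧ G.f w (n + G.dd i) ≤ m + c) : G.f v n ≤ m := by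
  apply G.coind (fun v' n' m' => v' = v ∧ n' = n ∧ m' = m) _ v n m ⟨rfl, rfl, rfl⟩
  rintro v' n' m' ⟨rfl, rfl, rfl⟩
  refine ⟨hn, hm, fun i hi => ?_⟩
  obtain ⟨w, c, h1, h2⟩ := h i hi
  exact ⟨w, c, h1, Or.inr h2⟩

/-- Gluing lemma: a shifted copy of the frontier dominates the frontier. -/
theorem shift (C : V → Prop) (a b i : ℤ) (hi : G.n1 ≤ i) (hia : G.n1 ≤ i + a)
    (h0 : ∀ v, C v → G.f v i ≤ G.f v (i + a) - b)
    (hK : ∀ v n, C v → i < n → G.K ≤ G.f v (n + a) - b)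
    (H : ∀ v w n d c, C v → ¬ C w → i < n → |d| ≤ 1 → |c| ≤ G.L →
      G.f w (n + a + d) ≤ G.f v (n + a) + c → G.f w (n + d) ≤ G.f v (n + a) - b + c) :
    ∀ v n, C v → i ≤ n → G.f v n ≤ G.f v (n + a) - b := by
  intro v n hv hn
  rcases hn.eq_or_lt with rfl | hn
  · exact h0 v hv
  apply G.coind (fun v n m => C v ∧ i < n ∧ G.f v (n + a) - b ≤ m) _ v n _ ⟨hv, hn, le_rfl⟩
  rintro v n m ⟨hv, hn, hm⟩
  refine ⟨by omega, (hK v n hv hn).trans hm, fun j hj => ?_⟩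
  obtain ⟨w, c, hR, hf⟩ := G.step v (n + a) (G.f v (n + a)) (by omega)
    (G.low _ _ (by omega)) le_rfl j hj
  refine ⟨w, c, hR, ?_⟩
  have hd := G.hdd v j hj
  have hd' := abs_le.1 hd
  by_cases hw : C w
  · by_cases hh : n + G.dd j = i
    · right
      have := h0 w hw
      rw [hh]
      have e : i + a = n + a + G.dd j := by omega
      rw [e] at this
      omega
    · left
      refine ⟨hw, by omega, ?_⟩
      have e : n + G.dd j + a = n + a + G.dd j := by omega
      rw [e]; omega
  · right
    have := H v w n _ c hv hw hn hd (G.hR _ _ _ _ hR) hf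
    omega

theorem linear_bound [Finite V] : ∃ B : ℤ, 0 ≤ B ∧ ∀ v n, G.n1 ≤ n →
    G.f v n ≤ G.f v G.n1 + B * (n - G.n1) := by
  obtain ⟨B0, hB0⟩ := Finite.exists_le (fun v => G.f v (G.n1 + 1) - G.f v G.n1)
  set B := max B0 0
  have hB : ∀ v, G.f v (G.n1 + 1) - G.f v G.n1 ≤ B := fun v => (hB0 v).trans (le_max_left _ _)
  have hB' : 0 ≤ B := le_max_right _ _
  have key := G.shift (fun _ => True) (-1) (-B) (G.n1 + 1) (by omega) (by omega)
    (fun v _ => by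
      have := hB v
      have e : G.n1 + 1 + -1 = G.n1 := by omega
      rw [e]; omega)
    (fun v n _ hn => by
      have := G.low v (n + -1) (by omega)
      omega)
    (fun v w n d c _ hw => absurd trivial hw)
  refine ⟨B, hB', fun v n hn => ?_⟩
  induction n, hn using Int.leInduction with
  | base => simp
  | succ n hn ih =>
    have := key v (n + 1) trivial (by omega)
    have e : n + 1 + -1 = n := by omega
    rw [e] at this
    nlinarith

/-- Spoiler wins the first-cycle game for slope `γ` avoiding `T`. -/
inductive Win (γ : ℝ) (T : V → Prop) : List (V × ℤ × ℤ) → Prop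
  | mk (v : V) (x y : ℤ) (h : List (V × ℤ × ℤ)) (i : I) (hT : ¬ T v) (hi : G.Mov v i)
    (hc : ∀ w c, G.R v i w c → ∀ x' y', (w, x', y') ∈ (v, x, y) :: h →
      ((y + c - y' : ℤ) : ℝ) - γ * ((x + G.dd i - x' : ℤ) : ℝ) < 0)
    (hw : ∀ w c, G.R v i w c → (∀ p, (w, p) ∉ (v, x, y) :: h) →
      Win γ T ((w, x + G.dd i, y + c) :: (v, x, y) :: h)) : Win γ T ((v, x, y) :: h)

/-- Valid memory states of the first-cycle game strategies. -/
def Good (P : List (V × ℤ × ℤ) → Prop) : List (V × ℤ × ℤ) → Prop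
  | [] => True
  | a :: h => P (a :: h) ∧ (∀ p, (a.1, p) ∉ h) ∧ |a.2.1| ≤ G.L * (h.length + 1) ∧
      |a.2.2| ≤ G.L * (h.length + 1) ∧ Good P h

theorem Good.suffix {P : List (V × ℤ × ℤ) → Prop} {w : V} {p : ℤ × ℤ} :
    ∀ {h : List (V × ℤ × ℤ)}, G.Good P h → (w, p) ∈ h → ∃ h', G.Good P ((w, p) :: h')
  | [], _, hm => by simp at hm
  | a :: h, hg, hm => by
    rcases List.mem_cons.1 hm with rfl | hm
    · exact ⟨h, hg⟩
    · exact Good.suffix hg.2.2.2.2 hm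

theorem Good.nodup {P : List (V × ℤ × ℤ) → Prop} :
    ∀ {h : List (V × ℤ × ℤ)}, G.Good P h → (h.map Prod.fst).Nodup
  | [], _ => by simp
  | a :: h, hg => by
    rw [List.map_cons, List.nodup_cons]
    refine ⟨?_, Good.nodup hg.2.2.2.2⟩
    intro hm
    obtain ⟨⟨x, p⟩, h1, h2⟩ := List.mem_map.1 hm
    simp only at h2
    subst h2
    exact hg.2.1 _ h1

variable [Fintype V]

theorem Good.length_le {P : List (V × ℤ × ℤ) → Prop} {h : List (V × ℤ × ℤ)}
    (hg : G.Good P h) : h.length ≤ Fintype.card V := by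
  have := hg.nodup.length_le_card
  simpa using this

/-- bound on positions recorded in memory -/
def BB : ℤ := G.L * (Fintype.card V)

theorem BB_nonneg : 0 ≤ G.BB := mul_nonneg (by have := G.hL; omega) (by positivity)

theorem Good.bound {P : List (V × ℤ × ℤ) → Prop} {v : V} {x y : ℤ} {h : List (V × ℤ × ℤ)}
    (hg : G.Good P ((v, x, y) :: h)) : |x| ≤ G.BB ∧ |y| ≤ G.BB := by
  have h1 := hg.length_le
  simp only [List.length_cons] at h1
  have h2 : G.L * (h.length + 1) ≤ G.BB := by
    unfold BB
    have : ((h.length : ℤ) + 1) ≤ (Fintype.card V : ℤ) := by exact_mod_cast h1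
    have := G.hL
    nlinarith
  exact ⟨hg.2.2.1.trans h2, hg.2.2.2.1.trans h2⟩

theorem Good.extend {P : List (V × ℤ × ℤ) → Prop} {v w : V} {x y d c : ℤ}
    {h : List (V × ℤ × ℤ)} (hg : G.Good P ((v, x, y) :: h)) (hd : |d| ≤ 1) (hc : |c| ≤ G.L)
    (hP : P ((w, x + d, y + c) :: (v, x, y) :: h)) (hn : ∀ p, (w, p) ∉ (v, x, y) :: h) :
    G.Good P ((w, x + d, y + c) :: (v, x, y) :: h) := by
  refine ⟨hP, hn, ?_, ?_, hg⟩
  · have h1 := hg.2.2.1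
    have := abs_add_le x d
    have := G.hL
    simp only [List.length_cons]
    push_cast
    simp only at h1
    linarith
  · have h1 := hg.2.2.2.1
    have := abs_add_le y c
    have := G.hL
    simp only [List.length_cons]
    push_cast
    simp only at h1
    linarith

theorem good_single {P : List (V × ℤ × ℤ) → Prop} {v : V} (h : P [(v, 0, 0)]) :
    G.Good P [(v, 0, 0)] := by
  have := G.hL
  refine ⟨h, by simp, ?_, ?_, trivial⟩ <;> simp <;> omega

theorem spoiler_step {γ : ℝ} {T : V → Prop} {v : V} {x y : ℤ} {h : List (V × ℤ × ℤ)}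
    (hg : G.Good (G.Win γ T) ((v, x, y) :: h)) :
    ¬ T v ∧ ∃ i, G.Mov v i ∧ ∀ w c, G.R v i w c → ∃ x' y' h',
      G.Good (G.Win γ T) ((w, x', y') :: h') ∧
      ((x' = x + G.dd i ∧ y' = y + c ∧ h'.length = h.length + 1) ∨
       ((y + c - y' : ℤ) : ℝ) - γ * ((x + G.dd i - x' : ℤ) : ℝ) < 0) := by
  have hw := hg.1
  cases hw with
  | mk _ _ _ _ i hT hi hc hw =>
    refine ⟨hT, i, hi, fun w c hR => ?_⟩
    by_cases hm : ∃ p, (w, p) ∈ (v, x, y) :: h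
    · obtain ⟨⟨x', y'⟩, hm⟩ := hm
      obtain ⟨h', hh⟩ := hg.suffix _ hm
      exact ⟨x', y', h', hh, Or.inr (hc w c hR x' y' hm)⟩
    · push Not at hm
      exact ⟨_, _, _, hg.extend _ (G.hdd v i hi) (G.hR _ _ _ _ hR) (hw w c hR hm) hm,
        Or.inl ⟨rfl, rfl, by simp⟩⟩

theorem dup_step {γ : ℝ} {T : V → Prop} {v : V} {x y : ℤ} {h : List (V × ℤ × ℤ)}
    (hg : G.Good (fun h => ¬ G.Win γ T h) ((v, x, y) :: h)) (hT : ¬ T v) (i : I)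
    (hi : G.Mov v i) :
    ∃ w c, G.R v i w c ∧ ∃ x' y' h',
      G.Good (fun h => ¬ G.Win γ T h) ((w, x', y') :: h') ∧
       0 ≤ ((y + c - y' : ℤ) : ℝ) - γ * ((x + G.dd i - x' : ℤ) : ℝ) := by
  by_contra hcon
  push Not at hcon
  apply hg.1
  refine Win.mk v x y h i hT hi ?_ ?_
  · intro w c hR x' y' hm
    obtain ⟨h', hh⟩ := hg.suffix _ hm
    exact hcon w c hR x' y' h' hh
  · intro w c hR hm
    by_contra hnw
    have := hcon w c hR _ _ _ (hg.extend _ (G.hdd v i hi) (G.hR _ _ _ _ hR) hnw hm)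
    simp at this

end Arena

namespace Arena
variable {V I : Type} (G : Arena V I) [Fintype V]

theorem lin_abs {γ : ℝ} {x y : ℤ} {B : ℤ} (hx : |x| ≤ B) (hy : |y| ≤ B) :
    |(y : ℝ) - γ * x| ≤ (1 + |γ|) * B := by
  have hx' : |(x : ℝ)| ≤ B := by exact_mod_cast hx
  have hy' : |(y : ℝ)| ≤ B := by exact_mod_cast hy
  calc |(y : ℝ) - γ * x| ≤ |(y : ℝ)| + |γ * x| := abs_sub _ _
    _ = |(y : ℝ)| + |γ| * |(x : ℝ)| := by rw [abs_mul]
    _ ≤ B + |γ| * B := by gcongr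
    _ = _ := by ring

theorem lower {γ α : ℝ} (hα : 0 < α) {T : V → Prop} {ε : ℝ} (hε : 0 < ε)
    (hcyc : ∀ z1 z2 : ℤ, |z1| ≤ 2 * G.BB + G.L → |z2| ≤ 2 * G.BB + G.L →
      (z2 : ℝ) - γ * z1 < 0 → (z2 : ℝ) - γ * z1 ≤ -ε ∧ (z2 : ℝ) - α * z1 ≤ 0)
    (hP : ∀ w, ¬ T w → ∃ M : ℝ, ∀ n : ℤ, G.n1 ≤ n → γ * n - M ≤ G.f w n)
    (v : V) (hv : G.Win γ T [(v, 0, 0)]) :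
    ∃ M : ℝ, ∀ n : ℤ, G.n1 ≤ n → α * n - M ≤ G.f v n := by
  classical
  obtain ⟨M0, hM0⟩ : ∃ M0 : ℝ, ∀ w, ¬ T w → ∀ n : ℤ, G.n1 ≤ n → γ * n - M0 ≤ G.f w n := by
    have : ∀ w, ∃ M : ℝ, ¬ T w → ∀ n : ℤ, G.n1 ≤ n → γ * n - M ≤ G.f w n := by
      intro w
      by_cases hw : T w
      · exact ⟨0, fun h => absurd hw h⟩
      · obtain ⟨M, hM⟩ := hP w hw
        exact ⟨M, fun _ => hM⟩
    choose M hM using this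
    obtain ⟨M0, h0⟩ := Finite.exists_le M
    exact ⟨M0, fun w hw n hn => by linarith [hM w hw n hn, h0 w]⟩
  set N : ℝ := (Fintype.card V : ℝ) with hN
  have hN0 : 0 ≤ N := by positivity
  obtain ⟨ε', hε', hεN⟩ : ∃ ε' : ℝ, 0 < ε' ∧ ε' * (N + 1) = ε :=
    ⟨ε / (N + 1), by positivity, by field_simp⟩
  have hB0 : (0 : ℝ) ≤ G.BB := by exact_mod_cast G.BB_nonneg
  have hLr : (1 : ℝ) ≤ G.L := by exact_mod_cast G.hL
  have hKr : (0 : ℝ) ≤ G.K := by exact_mod_cast G.hK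
  set M1 : ℝ := α * G.n1 + G.L + (1 + |α|) * G.BB with hM1
  set M2 : ℝ := M0 + 1 + (1 + |γ|) * G.BB + ε' * N with hM2
  have main : ∀ k : ℕ, ∀ (v : V) (x y : ℤ) (h : List (V × ℤ × ℤ)) (n m : ℤ),
      G.Good (G.Win γ T) ((v, x, y) :: h) → G.K - G.L ≤ m →
      ((m : ℝ) - α * n) - (y - α * x) ≤ -M1 →
      ((m : ℝ) - γ * n) - (y - γ * x) - ε' * (h.length + 1) ≤ -M2 + k * ε' →
      ¬ G.f v n ≤ m := by
    intro k
    induction k with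
    | zero =>
      intro v x y h n m hg hm h1 h2 hf
      obtain ⟨hx, hy⟩ := hg.bound
      have ha := abs_le.1 (lin_abs (γ := α) hx hy)
      have hb := abs_le.1 (lin_abs (γ := γ) hx hy)
      have hmr : (G.K : ℝ) - G.L ≤ m := by exact_mod_cast hm
      have hn : G.n1 ≤ n := by
        have : α * (G.n1 : ℝ) ≤ α * n := by linarith
        exact_mod_cast le_of_mul_le_mul_left this hα
      have hT := (G.spoiler_step hg).1
      have h3 := hM0 v hT n hn
      have hl := hg.length_le
      simp only [List.length_cons] at hl
      have hl' : ((h.length : ℝ) + 1) ≤ N := by rw [hN]; exact_mod_cast hl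
      have h4 : ε' * ((h.length : ℝ) + 1) ≤ ε' * N := by gcongr
      have h5 : (G.f v n : ℝ) ≤ m := by exact_mod_cast hf
      simp only [Nat.cast_zero, zero_mul, add_zero] at h2
      linarith
    | succ k ih =>
      intro v x y h n m hg hm h1 h2 hf
      obtain ⟨hx, hy⟩ := hg.bound
      have ha := abs_le.1 (lin_abs (γ := α) hx hy)
      have hmr : (G.K : ℝ) - G.L ≤ m := by exact_mod_cast hm
      have hn : G.n1 ≤ n := by
        have : α * (G.n1 : ℝ) ≤ α * n := by linarith
        exact_mod_cast le_of_mul_le_mul_left this hα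
      have hmK : G.K ≤ m := (G.low v n hn).trans hf
      obtain ⟨hT, i, hi, hresp⟩ := G.spoiler_step hg
      obtain ⟨w, c, hR, hfw⟩ := G.step v n m hn hmK hf i hi
      obtain ⟨x', y', h', hg', hcase⟩ := hresp w c hR
      have hc := abs_le.1 (G.hR _ _ _ _ hR)
      have hd := abs_le.1 (G.hdd _ _ hi)
      have hl := hg.length_le
      simp only [List.length_cons] at hl
      have hl' : ((h.length : ℝ) + 1) ≤ N := by rw [hN]; exact_mod_cast hl
      push_cast at h2
      rcases hcase with ⟨rfl, rfl, hlen⟩ | hneg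
      · refine ih w _ _ h' _ _ hg' (by omega) ?_ ?_ hfw
        · push_cast; linarith
        · rw [hlen]; push_cast; linarith
      · obtain ⟨hx', hy'⟩ := hg'.bound
        have hL := G.hL
        rw [abs_le] at hx hy hx' hy'
        have hz := hcyc (x + G.dd i - x') (y + c - y') (abs_le.2 (by omega))
          (abs_le.2 (by omega)) hneg
        push_cast at hz
        refine ih w _ _ h' _ _ hg' (by omega) ?_ ?_ hfw
        · push_cast; linarith
        · push_cast
          have e1 : ε' * ((h.length : ℝ) + 1) ≤ ε' * N := by gcongr
          have e2 : 0 ≤ ε' * ((h'.length : ℝ) + 1) := by positivity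
          linarith
  refine ⟨M1, fun n hn => ?_⟩
  by_contra hcon
  push Not at hcon
  obtain ⟨k, hk⟩ := exists_nat_ge ((((G.f v n : ℝ) - γ * n) + M2) / ε')
  rw [div_le_iff₀ hε'] at hk
  refine main k v 0 0 [] n (G.f v n) (G.good_single hv) ?_ ?_ ?_ le_rfl
  · have := G.low v n hn
    have := G.hL
    omega
  · push_cast; linarith
  · push_cast
    simp
    linarith

theorem upper {γ : ℝ} (hγ : 0 ≤ γ) {T : V → Prop}
    (hT : ∀ w, T w → ∃ M : ℝ, ∀ n : ℤ, G.n1 ≤ n → (G.f w n : ℝ) ≤ γ * n + M)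
    (v : V) (hv : ¬ G.Win γ T [(v, 0, 0)]) :
    ∃ M : ℝ, ∀ n : ℤ, G.n1 ≤ n → (G.f v n : ℝ) ≤ γ * n + M := by
  classical
  by_cases hTv : T v
  · exact hT v hTv
  obtain ⟨M0, hM0⟩ : ∃ M0 : ℝ, ∀ w, T w → ∀ n : ℤ, G.n1 ≤ n → (G.f w n : ℝ) ≤ γ * n + M0 := by
    have : ∀ w, ∃ M : ℝ, T w → ∀ n : ℤ, G.n1 ≤ n → (G.f w n : ℝ) ≤ γ * n + M := by
      intro w
      by_cases hw : T w
      · obtain ⟨M, hM⟩ := hT w hw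
        exact ⟨M, fun _ => hM⟩
      · exact ⟨0, fun h => absurd h hw⟩
    choose M hM using this
    obtain ⟨M0, h0⟩ := Finite.exists_le M
    exact ⟨M0, fun w hw n hn => by linarith [hM w hw n hn, h0 w]⟩
  obtain ⟨F0, hF0⟩ := Finite.exists_le (fun w => (G.f w (G.n1 - 1) : ℝ))
  have hB0 : (0 : ℝ) ≤ G.BB := by exact_mod_cast G.BB_nonneg
  have hKr : (0 : ℝ) ≤ G.K := by exact_mod_cast G.hK
  have hn1r : (0 : ℝ) ≤ G.n1 := by exact_mod_cast G.hn1
  set M2 : ℝ := (1 + |γ|) * G.BB + G.K + |M0| + |F0| + γ with hM2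
  have hM0' := le_abs_self M0
  have hF0' := le_abs_self F0
  have hM0'' := abs_nonneg M0
  have hF0'' := abs_nonneg F0
  have main := G.coind (fun v n m => G.n1 ≤ n ∧ ¬ T v ∧ ∃ x y h,
    G.Good (fun h => ¬ G.Win γ T h) ((v, x, y) :: h) ∧
    M2 ≤ ((m : ℝ) - γ * n) - (y - γ * x)) (by
      rintro v n m ⟨hn, hTv, x, y, h, hg, hm⟩
      obtain ⟨hx, hy⟩ := hg.bound
      have ha := abs_le.1 (lin_abs (γ := γ) hx hy)
      have hnr : (G.n1 : ℝ) ≤ n := by exact_mod_cast hn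
      have hgn : 0 ≤ γ * n := mul_nonneg hγ (hn1r.trans hnr)
      refine ⟨hn, ?_, fun i hi => ?_⟩
      · have : (G.K : ℝ) ≤ m := by linarith
        exact_mod_cast this
      obtain ⟨w, c, hR, x', y', h', hg', hz⟩ := G.dup_step hg hTv i hi
      refine ⟨w, c, hR, ?_⟩
      obtain ⟨hx', hy'⟩ := hg'.bound
      have ha' := abs_le.1 (lin_abs (γ := γ) hx' hy')
      have hd := abs_le.1 (G.hdd _ _ hi)
      have hm' : M2 ≤ (((m + c : ℤ) : ℝ) - γ * ((n + G.dd i : ℤ) : ℝ)) - (y' - γ * x') := by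
        push_cast at hz ⊢
        linarith
      by_cases hn' : n + G.dd i < G.n1
      · right
        have e : n + G.dd i = G.n1 - 1 := by omega
        rw [e] at hm' ⊢
        have h1 := hF0 w
        have h2 : 0 ≤ γ * (G.n1 : ℝ) := mul_nonneg hγ hn1r
        have : (G.f w (G.n1 - 1) : ℝ) ≤ ((m + c : ℤ) : ℝ) := by
          push_cast at hm' ⊢
          linarith
        exact_mod_cast this
      · push Not at hn'
        by_cases hTw : T w
        · right
          have h1 := hM0 w hTw _ hn'
          have : (G.f w (n + G.dd i) : ℝ) ≤ ((m + c : ℤ) : ℝ) := by linarith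
          exact_mod_cast this
        · left
          exact ⟨hn', hTw, x', y', h', hg', hm'⟩)
  refine ⟨M2 + 1, fun n hn => ?_⟩
  have h1 := main v n ⌈γ * n + M2⌉ ⟨hn, hTv, 0, 0, [], G.good_single hv, by
    have := Int.le_ceil (γ * n + M2)
    push_cast
    linarith⟩
  have h2 : (G.f v n : ℝ) ≤ (⌈γ * n + M2⌉ : ℤ) := by exact_mod_cast h1
  have h3 := Int.ceil_lt_add_one (γ * n + M2)
  linarith

theorem finset_eps {ι : Type} (s : Finset ι) (g : ι → ℝ) (hg : ∀ i ∈ s, 0 < g i) :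
    ∃ ε : ℝ, 0 < ε ∧ ∀ i ∈ s, ε ≤ g i := by
  classical
  induction s using Finset.induction_on with
  | empty => exact ⟨1, one_pos, by simp⟩
  | insert a s ha ih =>
    obtain ⟨ε, h1, h2⟩ := ih (fun i hi => hg i (Finset.mem_insert_of_mem hi))
    refine ⟨min ε (g a), lt_min h1 (hg a (Finset.mem_insert_self _ _)), ?_⟩
    intro i hi
    rcases Finset.mem_insert.1 hi with rfl | hi
    · exact min_le_right _ _
    · exact (min_le_left _ _).trans (h2 i hi)

theorem eps_exists (γ : ℝ) (B : ℤ) : ∃ ε : ℝ, 0 < ε ∧ ∀ z1 z2 : ℤ, |z1| ≤ B → |z2| ≤ B →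
    (z2 : ℝ) - γ * z1 < 0 → (z2 : ℝ) - γ * z1 ≤ -ε := by
  classical
  obtain ⟨ε, h1, h2⟩ := finset_eps
    (((Finset.Icc (-B) B) ×ˢ (Finset.Icc (-B) B)).filter
      (fun z : ℤ × ℤ => (z.2 : ℝ) - γ * z.1 < 0)) (fun z => -((z.2 : ℝ) - γ * z.1))
    (fun z hz => by have := (Finset.mem_filter.1 hz).2; linarith)
  refine ⟨ε, h1, fun z1 z2 hz1 hz2 h => ?_⟩
  have := h2 (z1, z2) (Finset.mem_filter.2 ⟨Finset.mem_product.2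
    ⟨Finset.mem_Icc.2 (abs_le.1 hz1), Finset.mem_Icc.2 (abs_le.1 hz2)⟩, h⟩)
  simp only at this
  linarith

/-- Upper slope. -/
noncomputable def u (v : V) : ℝ :=
  sInf {γ : ℝ | 0 ≤ γ ∧ ∃ M : ℝ, ∀ n : ℤ, G.n1 ≤ n → (G.f v n : ℝ) ≤ γ * n + M}

theorem u_le {v : V} {γ M : ℝ} (hγ : 0 ≤ γ)
    (h : ∀ n : ℤ, G.n1 ≤ n → (G.f v n : ℝ) ≤ γ * n + M) : G.u v ≤ γ :=
  csInf_le ⟨0, fun _ hx => hx.1⟩ ⟨hγ, M, h⟩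

theorem u_set_nonempty (v : V) : {γ : ℝ | 0 ≤ γ ∧ ∃ M : ℝ, ∀ n : ℤ, G.n1 ≤ n →
    (G.f v n : ℝ) ≤ γ * n + M}.Nonempty := by
  obtain ⟨B, hB, h⟩ := G.linear_bound
  have hBr : (0 : ℝ) ≤ B := by exact_mod_cast hB
  refine ⟨B, hBr, G.f v G.n1, fun n hn => ?_⟩
  have h1 : (G.f v n : ℝ) ≤ G.f v G.n1 + B * (n - G.n1) := by exact_mod_cast h v n hn
  have hn1r : (0 : ℝ) ≤ G.n1 := by exact_mod_cast G.hn1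
  nlinarith

theorem u_nonneg (v : V) : 0 ≤ G.u v := le_csInf (G.u_set_nonempty v) (fun _ h => h.1)

theorem upper_of_u_lt {v : V} {γ : ℝ} (h : G.u v < γ) :
    ∃ M : ℝ, ∀ n : ℤ, G.n1 ≤ n → (G.f v n : ℝ) ≤ γ * n + M := by
  obtain ⟨γ', ⟨h0, M, hM⟩, hlt⟩ := exists_lt_of_csInf_lt (G.u_set_nonempty v) h
  refine ⟨M, fun n hn => (hM n hn).trans ?_⟩
  have hnr : (0 : ℝ) ≤ n := by exact_mod_cast G.hn1.trans hn
  nlinarith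

theorem le_u {v : V} {α M : ℝ} (h : ∀ n : ℤ, G.n1 ≤ n → α * n - M ≤ G.f v n) : α ≤ G.u v := by
  by_contra hcon
  push Not at hcon
  obtain ⟨γ, h1, h2⟩ := exists_between hcon
  obtain ⟨M', hM'⟩ := G.upper_of_u_lt h1
  obtain ⟨k, hk⟩ := exists_nat_gt ((M + M') / (α - γ))
  rw [div_lt_iff₀ (by linarith)] at hk
  have ha := h (max G.n1 k) (le_max_left _ _)
  have hb := hM' (max G.n1 k) (le_max_left _ _)
  have hkk : (k : ℝ) ≤ ((max G.n1 k : ℤ) : ℝ) := by exact_mod_cast le_max_right _ _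
  nlinarith

theorem notwin_upper {γ : ℝ} (hγ : 0 ≤ γ) {v : V}
    (hv : ¬ G.Win γ (fun w => G.u w < γ) [(v, 0, 0)]) :
    ∃ M : ℝ, ∀ n : ℤ, G.n1 ≤ n → (G.f v n : ℝ) ≤ γ * n + M :=
  G.upper hγ (fun _ hw => G.upper_of_u_lt hw) v hv

/-- Lower bounds at slope `γ`. -/
def PP (γ : ℝ) : Prop :=
  ∀ w, γ ≤ G.u w → ∃ M : ℝ, ∀ n : ℤ, G.n1 ≤ n → γ * n - M ≤ G.f w n

theorem right_step {γ : ℝ} (hγ : 0 ≤ γ) (hP : G.PP γ) : ∃ c : ℝ, 0 < c ∧ ∀ α, γ < α → α ≤ γ + c →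
    ∀ v, G.Win γ (fun w => G.u w < γ) [(v, 0, 0)] →
      ∃ M : ℝ, ∀ n : ℤ, G.n1 ≤ n → α * n - M ≤ G.f v n := by
  have hB0 := G.BB_nonneg
  have hL := G.hL
  set B := 2 * G.BB + G.L with hB
  have hBr : (0 : ℝ) < B := by
    have : 0 < B := by omega
    exact_mod_cast this
  obtain ⟨ε, hε, h⟩ := eps_exists γ B
  refine ⟨ε / B, by positivity, fun α h1 h2 v hv => ?_⟩
  refine G.lower (by linarith) hε (fun z1 z2 hz1 hz2 hz => ⟨h z1 z2 hz1 hz2 hz, ?_⟩)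
    (fun w hw => hP w (not_lt.1 hw)) v hv
  have h3 := h z1 z2 hz1 hz2 hz
  have h4 : -(B : ℝ) ≤ z1 := by exact_mod_cast (abs_le.1 hz1).1
  have h5 : (α - γ) * B ≤ ε := by
    have : α - γ ≤ ε / B := by linarith
    rwa [le_div_iff₀ hBr] at this
  nlinarith

theorem left_step {α : ℝ} (hα : 0 < α) (hP : ∀ γ, 0 ≤ γ → γ < α → G.PP γ) : G.PP α := by
  have hB0 := G.BB_nonneg
  have hL := G.hL
  set B := 2 * G.BB + G.L with hB
  have hBr : (0 : ℝ) < B := by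
    have : 0 < B := by omega
    exact_mod_cast this
  obtain ⟨ε, hε, h⟩ := eps_exists α B
  intro v hv
  -- choose γ < α close to α
  obtain ⟨γ, hγ0, hγα, hγc, hγu⟩ : ∃ γ : ℝ, 0 ≤ γ ∧ γ < α ∧ (α - γ) * B < ε ∧
      ∀ w, G.u w < α → G.u w < γ := by
    classical
    obtain ⟨c, hc, hc'⟩ := finset_eps (Finset.univ.filter (fun w => G.u w < α))
      (fun w => α - G.u w) (fun w hw => by have := (Finset.mem_filter.1 hw).2; linarith)
    set e := min (min α (c / 2)) (ε / (2 * B)) with he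
    have he0 : 0 < e := by positivity
    have e1 : e ≤ α := (min_le_left _ _).trans (min_le_left _ _)
    have e2 : e ≤ c / 2 := (min_le_left _ _).trans (min_le_right _ _)
    have e3 : e ≤ ε / (2 * B) := min_le_right _ _
    refine ⟨α - e, by linarith, by linarith, ?_, fun w hw => ?_⟩
    · rw [le_div_iff₀ (by positivity)] at e3
      nlinarith
    · have := hc' w (Finset.mem_filter.2 ⟨Finset.mem_univ _, hw⟩)
      linarith
  obtain ⟨ε2, hε2, h2⟩ := eps_exists γ B
  have hwin : G.Win γ (fun w => G.u w < γ) [(v, 0, 0)] := by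
    by_contra hn
    obtain ⟨M, hM⟩ := G.notwin_upper hγ0 hn
    have := G.u_le hγ0 hM
    linarith
  refine G.lower hα hε2 (fun z1 z2 hz1 hz2 hz => ⟨h2 z1 z2 hz1 hz2 hz, ?_⟩)
    (fun w hw => hP γ hγ0 hγα w (not_lt.1 hw)) v hwin
  by_contra hcon
  push Not at hcon
  have h3 := h (-z1) (-z2) (by rwa [abs_neg]) (by rwa [abs_neg]) (by push_cast; linarith)
  push_cast at h3
  have h4 : -(B : ℝ) ≤ z1 := by exact_mod_cast (abs_le.1 hz1).1
  nlinarith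

theorem PP_all (b : ℝ) (hb : 0 ≤ b) : G.PP b := by
  have h0 : G.PP 0 := by
    intro w _
    refine ⟨0, fun n hn => ?_⟩
    have : (0 : ℝ) ≤ G.f w n := by exact_mod_cast G.hK.trans (G.low w n hn)
    simpa using this
  set A : Set ℝ := {x | 0 ≤ x ∧ ∀ y, 0 ≤ y → y ≤ x → G.PP y} with hA
  by_contra hcon
  have hbd : ∀ x ∈ A, x ≤ b := by
    intro x hx
    by_contra h
    exact hcon (hx.2 b hb (by linarith))
  have hne : (0 : ℝ) ∈ A := ⟨le_rfl, fun y h1 h2 => by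
    have : y = 0 := le_antisymm h2 h1
    rwa [this]⟩
  set s := sSup A with hs
  have hs0 : 0 ≤ s := le_csSup ⟨b, hbd⟩ hne
  have hlt : ∀ y, 0 ≤ y → y < s → G.PP y := by
    intro y hy hys
    obtain ⟨x, hx, hyx⟩ := exists_lt_of_lt_csSup ⟨0, hne⟩ hys
    exact hx.2 y hy hyx.le
  have hPs : G.PP s := by
    rcases hs0.eq_or_lt with h | h
    · rwa [← h]
    · exact G.left_step h hlt
  obtain ⟨c, hc, hr⟩ := G.right_step hs0 hPs
  have hmem : s + c ∈ A := by
    refine ⟨by linarith, fun y hy hyc => ?_⟩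
    rcases lt_trichotomy y s with h | h | h
    · exact hlt y hy h
    · rwa [h]
    · intro w hw
      refine hr y h hyc w ?_
      by_contra hn
      obtain ⟨M, hM⟩ := G.notwin_upper hs0 hn
      have := G.u_le hs0 hM
      linarith
  have := le_csSup ⟨b, hbd⟩ hmem
  linarith

theorem belt (v : V) : ∃ M : ℝ, ∀ n : ℤ, G.n1 ≤ n → |(G.f v n : ℝ) - G.u v * n| ≤ M := by
  have hP := G.PP_all _ (G.u_nonneg v)
  obtain ⟨M, hM⟩ := hP v le_rfl
  obtain ⟨c, hc, hr⟩ := G.right_step (G.u_nonneg v) hP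
  obtain ⟨M', hM'⟩ : ∃ M : ℝ, ∀ n : ℤ, G.n1 ≤ n → (G.f v n : ℝ) ≤ G.u v * n + M := by
    apply G.notwin_upper (G.u_nonneg v)
    intro hw
    obtain ⟨M2, hM2⟩ := hr (G.u v + c) (by linarith) le_rfl v hw
    have := G.le_u hM2
    linarith
  refine ⟨max M M', fun n hn => abs_le.2 ⟨?_, ?_⟩⟩
  · have := hM n hn; have := le_max_left M M'; linarith
  · have := hM' n hn; have := le_max_right M M'; linarith

end Arena

namespace Arena
variable {V I : Type} (G : Arena V I) [Fintype V]

theorem periodic (hunb : ∀ v X, ∃ n, G.n1 ≤ n ∧ X ≤ G.f v n) (v : V) :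
    ∃ i a b : ℤ, G.n1 ≤ i ∧ 1 ≤ a ∧ ∀ n, i ≤ n → G.f v (n + a) = G.f v n + b := by
  classical
  obtain ⟨M, hM⟩ : ∃ M : ℝ, ∀ w, ∀ n : ℤ, G.n1 ≤ n → |(G.f w n : ℝ) - G.u w * n| ≤ M := by
    choose M hM using G.belt
    obtain ⟨M0, h0⟩ := Finite.exists_le M
    exact ⟨M0, fun w n hn => (hM w n hn).trans (h0 w)⟩
  have hM0 : 0 ≤ M := (abs_nonneg _).trans (hM v G.n1 le_rfl)
  set β := G.u v with hβ
  have hβ0 : 0 < β := by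
    rcases (G.u_nonneg v).eq_or_lt with h | h
    · exfalso
      obtain ⟨n, hn, hX⟩ := hunb v (⌈M⌉ + 1)
      have h1 := (abs_le.1 (hM v n hn)).2
      rw [← hβ, hβ, ← h] at h1
      have h2 : ((⌈M⌉ + 1 : ℤ) : ℝ) ≤ G.f v n := by exact_mod_cast hX
      have h3 := Int.le_ceil M
      push_cast at h2
      linarith
    · exact h
  obtain ⟨δ, hδ, hδw⟩ := finset_eps (Finset.univ.filter (fun w => G.u w ≠ β))
    (fun w => |G.u w - β|)
    (fun w hw => abs_pos.2 (sub_ne_zero.2 (Finset.mem_filter.1 hw).2))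
  have hKr : (0 : ℝ) ≤ G.K := by exact_mod_cast G.hK
  have hLr : (1 : ℝ) ≤ G.L := by exact_mod_cast G.hL
  obtain ⟨k0, hk0⟩ := exists_nat_gt (max ((G.K + 3 * M) / β) ((β + δ + 4 * M + G.L) / δ))
  have hka : G.K + 3 * M < k0 * β := by
    have := (le_max_left _ _).trans_lt hk0
    rwa [div_lt_iff₀ hβ0] at this
  have hkb : β + δ + 4 * M + G.L < k0 * δ := by
    have := (le_max_right _ _).trans_lt hk0
    rwa [div_lt_iff₀ hδ] at this
  set n2 : ℤ := max (G.n1 + 1) k0 with hn2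
  have hn2a : G.n1 + 1 ≤ n2 := le_max_left _ _
  have hn2b : (k0 : ℤ) ≤ n2 := le_max_right _ _
  have key : ∀ a b i : ℤ, n2 ≤ i → n2 ≤ i + a → |(b : ℝ) - β * a| ≤ 2 * M →
      (∀ w, G.u w = β → G.f w i ≤ G.f w (i + a) - b) →
      ∀ w n, G.u w = β → i ≤ n → G.f w n ≤ G.f w (n + a) - b := by
    intro a b i hi hia hab h0
    have hab' := abs_le.1 hab
    refine G.shift (fun w => G.u w = β) a b i (by omega) (by omega) h0 ?_ ?_
    · intro w n hw hn
      have h1 := (abs_le.1 (hM w (n + a) (by omega))).1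
      rw [hw] at h1
      have h2 : (k0 : ℝ) ≤ n := by
        have : (k0 : ℤ) ≤ n := by omega
        exact_mod_cast this
      have : (G.K : ℝ) ≤ ((G.f w (n + a) - b : ℤ) : ℝ) := by
        push_cast at h1 ⊢
        nlinarith
      exact_mod_cast this
    · intro x w n d c hx hw hn hd hc hf
      have hd1 := abs_le.1 hd
      have hdr : |(d : ℝ)| ≤ 1 := by exact_mod_cast hd
      have hdr' := abs_le.1 hdr
      have hcr : |(c : ℝ)| ≤ G.L := by exact_mod_cast hc
      have hcr' := abs_le.1 hcr
      have h1 := abs_le.1 (hM x (n + a) (by omega))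
      rw [hx] at h1
      have h2 : (k0 : ℝ) ≤ n := by
        have : (k0 : ℤ) ≤ n := by omega
        exact_mod_cast this
      have h3 : (k0 : ℝ) ≤ n + a := by
        have : (k0 : ℤ) ≤ n + a := by omega
        exact_mod_cast this
      have hu := G.u_nonneg w
      have hgap := hδw w (Finset.mem_filter.2 ⟨Finset.mem_univ _, hw⟩)
      have hkn : k0 * δ ≤ n * δ := by gcongr
      have hkn' : k0 * δ ≤ (n + a) * δ := by gcongr
      have hfr : (G.f w (n + a + d) : ℝ) ≤ G.f x (n + a) + c := by exact_mod_cast hf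
      rcases lt_or_gt_of_ne hw with hlt | hgt
      · rw [abs_of_neg (by linarith)] at hgap
        have h4 := (abs_le.1 (hM w (n + d) (by omega))).2
        have : (G.f w (n + d) : ℝ) ≤ ((G.f x (n + a) - b + c : ℤ) : ℝ) := by
          push_cast at h1 h4 ⊢
          have e1 : G.u w * n ≤ (β - δ) * n := by
            apply mul_le_mul_of_nonneg_right (by linarith)
            have : (0 : ℝ) ≤ k0 := by positivity
            linarith
          have e2 : G.u w * d ≤ β := by nlinarith
          linarith
        exact_mod_cast this
      · exfalso
        rw [abs_of_pos (by linarith)] at hgap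
        have h4 := (abs_le.1 (hM w (n + a + d) (by omega))).1
        push_cast at h1 h4
        have hnd : (0 : ℝ) ≤ n + a + d := by
          have : 0 ≤ n + a + d := by have := G.hn1; omega
          exact_mod_cast this
        have e1 : (β + δ) * (n + a + d) ≤ G.u w * (n + a + d) := by
          apply mul_le_mul_of_nonneg_right (by linarith) hnd
        have e2 : -(β + δ) ≤ (β + δ) * d := by nlinarith
        linarith
  -- pigeonhole on shapes
  set M' : ℤ := ⌈M⌉ + 1 with hM'
  have hM'r : M + 1 ≤ (M' : ℝ) := by
    have := Int.le_ceil M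
    rw [hM']; push_cast; linarith
  have hbound : ∀ (k : ℕ) (w : V), (if G.u w = β then G.f w (n2 + k) - ⌊β * ((n2 + k : ℤ) : ℝ)⌋
      else 0) ∈ Set.Icc (-M') M' := by
    intro k w
    split_ifs with hw
    · have h1 := abs_le.1 (hM w (n2 + k) (by omega))
      rw [hw] at h1
      have h2 := Int.floor_le (β * ((n2 + k : ℤ) : ℝ))
      have h3 := Int.lt_floor_add_one (β * ((n2 + k : ℤ) : ℝ))
      constructor
      · have : ((-M' : ℤ) : ℝ) ≤ ((G.f w (n2 + k) - ⌊β * ((n2 + k : ℤ) : ℝ)⌋ : ℤ) : ℝ) := by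
          push_cast at h1 h2 h3 ⊢
          linarith
        exact_mod_cast this
      · have : ((G.f w (n2 + k) - ⌊β * ((n2 + k : ℤ) : ℝ)⌋ : ℤ) : ℝ) ≤ ((M' : ℤ) : ℝ) := by
          push_cast at h1 h2 h3 ⊢
          linarith
        exact_mod_cast this
    · have : (0 : ℝ) ≤ M' := by linarith
      have : 0 ≤ M' := by exact_mod_cast this
      constructor <;> omega
  let g : ℕ → (V → Set.Icc (-M') M') := fun k w => ⟨_, hbound k w⟩
  obtain ⟨k1, k2, hlt, heq⟩ : ∃ k1 k2 : ℕ, k1 < k2 ∧ g k1 = g k2 := by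
    obtain ⟨k1, k2, hne, he⟩ := Finite.exists_ne_map_eq_of_infinite g
    rcases lt_or_gt_of_ne hne with h | h
    · exact ⟨k1, k2, h, he⟩
    · exact ⟨k2, k1, h, he.symm⟩
  set b : ℤ := ⌊β * ((n2 + k2 : ℤ) : ℝ)⌋ - ⌊β * ((n2 + k1 : ℤ) : ℝ)⌋ with hb
  have hsh : ∀ w, G.u w = β → G.f w (n2 + k2) = G.f w (n2 + k1) + b := by
    intro w hw
    have h1 := congrArg Subtype.val (congrFun heq w)
    simp only [g, hw, if_true] at h1
    omega
  set a : ℤ := (k2 : ℤ) - k1 with ha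
  have hab : |(b : ℝ) - β * a| ≤ 2 * M := by
    have h1 := abs_le.1 (hM v (n2 + k1) (by omega))
    have h2 := abs_le.1 (hM v (n2 + k2) (by omega))
    have h3 := hsh v rfl
    have h3' : (G.f v (n2 + k2) : ℝ) = G.f v (n2 + k1) + b := by exact_mod_cast h3
    rw [← hβ] at h1 h2
    rw [h3'] at h2
    have e : (a : ℝ) = k2 - k1 := by rw [ha]; push_cast; rfl
    rw [e]
    push_cast at h1 h2
    rw [abs_le]
    constructor <;> linarith
  have e12 : n2 + (k1 : ℤ) + a = n2 + k2 := by omega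
  have e21 : n2 + (k2 : ℤ) + -a = n2 + k1 := by omega
  have up := key a b (n2 + k1) (by omega) (by omega) hab (fun w hw => by
    rw [e12, hsh w hw]; omega)
  have dn := key (-a) (-b) (n2 + k2) (by omega) (by omega) (by
    push_cast
    rw [abs_le] at hab ⊢
    constructor <;> linarith) (fun w hw => by
    rw [e21, hsh w hw]; omega)
  refine ⟨n2 + k1, a, b, by omega, by omega, fun n hn => le_antisymm ?_ ?_⟩
  · have := dn v (n + a) rfl (by omega)
    have e : n + a + -a = n := by omega
    rw [e] at this
    omega
  · have := up v n rfl hn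
    omega

end Arena

namespace OCN
variable {Q A : Type} (N : OCN Q A)

theorem Step.shift {N : OCN Q A} {q p : Q} {m m' : ℕ} {a : A} (h : N.Step (q, m) a (p, m')) (k : ℕ) :
    N.Step (q, m + k) a (p, m' + k) := by
  obtain ⟨d, h1, h2⟩ := h
  refine ⟨d, h1, ?_⟩
  simp only at h2 ⊢
  push_cast
  omega

theorem Step.le {N : OCN Q A} {c c' : Q × ℕ} {a : A} (h : N.Step c a c') :
    c'.2 ≤ c.2 + 1 := by
  obtain ⟨d, h1, h2⟩ := h
  have := N.effect_bounded _ _ _ _ h1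
  omega

theorem tau_shift {τ : A} {c c' : Q × ℕ} (h : TauReach N.Step τ c c') (k : ℕ) :
    TauReach N.Step τ (c.1, c.2 + k) (c'.1, c'.2 + k) := by
  induction h with
  | refl => exact Relation.ReflTransGen.refl
  | tail _ h ih => exact ih.tail (Step.shift (N := N) h k)

theorem tau_cross {τ : A} {c c' : Q × ℕ} (h : TauReach N.Step τ c c') (x : ℕ) :
    c.2 ≤ x → x ≤ c'.2 → ∃ s, TauReach N.Step τ c (s, x) ∧ TauReach N.Step τ (s, x) c' := by
  induction h using Relation.ReflTransGen.head_induction_on with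
  | refl =>
    intro h1 h2
    obtain rfl : x = c'.2 := by omega
    exact ⟨c'.1, Relation.ReflTransGen.refl, Relation.ReflTransGen.refl⟩
  | @head u w h h' ih =>
    intro h1 h2
    rcases h1.eq_or_lt with rfl | h1
    · exact ⟨u.1, Relation.ReflTransGen.refl, Relation.ReflTransGen.head h h'⟩
    · obtain ⟨s, h3, h4⟩ := ih (by have := Step.le h; omega) h2
      exact ⟨s, Relation.ReflTransGen.head h h3, h4⟩

theorem tau_seq {τ : A} {q p : Q} {m m' : ℕ} (h : TauReach N.Step τ (q, m) (p, m')) (k : ℕ) :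
    m + k ≤ m' → ∃ s : ℕ → Q, (∀ i j, i ≤ j → j ≤ k → TauReach N.Step τ (s i, m + i) (s j, m + j)) ∧
      (∀ i, i ≤ k → TauReach N.Step τ (q, m) (s i, m + i) ∧
        TauReach N.Step τ (s i, m + i) (p, m')) := by
  induction k with
  | zero =>
    intro _
    refine ⟨fun _ => q, fun i j hij hj => ?_, fun i hi => ?_⟩
    · obtain rfl : j = 0 := by omega
      obtain rfl : i = 0 := by omega
      exact Relation.ReflTransGen.refl
    · obtain rfl : i = 0 := by omega
      exact ⟨Relation.ReflTransGen.refl, h⟩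
  | succ k ih =>
    intro hk
    obtain ⟨s, h1, h2⟩ := ih (by omega)
    obtain ⟨t, h3, h4⟩ := N.tau_cross (h2 k le_rfl).2 (m + (k + 1)) (by simp) hk
    have key : ∀ i, i ≤ k → TauReach N.Step τ (s i, m + i) (t, m + (k + 1)) :=
      fun i hi => (h1 i k hi le_rfl).trans h3
    refine ⟨fun i => if i ≤ k then s i else t, fun i j hij hj => ?_, fun i hi => ?_⟩
    · by_cases hjk : j ≤ k
      · simpa [hjk, hij.trans hjk] using h1 i j hij hjk
      · obtain rfl : j = k + 1 := by omega
        by_cases hik : i ≤ k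
        · simpa [hik] using key i hik
        · obtain rfl : i = k + 1 := by omega
          exact Relation.ReflTransGen.refl
    · by_cases hik : i ≤ k
      · simpa [hik] using h2 i hik
      · obtain rfl : i = k + 1 := by omega
        simp only [hik, if_false]
        exact ⟨(h2 k le_rfl).1.trans h3, h4⟩

theorem tau_pump [Fintype Q] {τ : A} {q p : Q} {m m' : ℕ} (h : TauReach N.Step τ (q, m) (p, m'))
    (hm : m + Fintype.card Q ≤ m') (X : ℕ) : ∃ k, X ≤ k ∧ TauReach N.Step τ (q, m) (p, m' + k) := by
  obtain ⟨s, h1, h2⟩ := N.tau_seq h _ hm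
  obtain ⟨i, j, hij, he⟩ : ∃ i j : Fin (Fintype.card Q + 1), i < j ∧ s i = s j := by
    obtain ⟨i, j, hne, he⟩ := Fintype.exists_ne_map_eq_of_card_lt
      (fun i : Fin (Fintype.card Q + 1) => s i) (by simp)
    rcases lt_or_gt_of_ne hne with h | h
    · exact ⟨i, j, h, he⟩
    · exact ⟨j, i, h, he.symm⟩
  have hij' : (i : ℕ) < j := hij
  have hloop := h1 i j hij'.le (by omega)
  rw [← he] at hloop
  have hall : ∀ t : ℕ, TauReach N.Step τ (s i, m + i) (s i, m + i + t * (j - i)) := by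
    intro t
    induction t with
    | zero =>
      simp only [Nat.zero_mul]
      exact Relation.ReflTransGen.refl
    | succ t ih =>
      have := N.tau_shift hloop (t * (j - i))
      refine ih.trans ?_
      have e : m + (j : ℕ) + t * (j - i) = m + i + (t + 1) * (j - i) := by
        have : (j : ℕ) = i + (j - i) := by omega
        rw [add_mul]; omega
      simp only [e] at this
      exact this
  refine ⟨X * (j - i), Nat.le_mul_of_pos_right _ (by omega), ?_⟩
  have := N.tau_shift (h2 i (by omega)).2 (X * (j - i))
  exact ((h2 i (by omega)).1.trans (hall X)).trans this

theorem weak_shift {τ a : A} {q p : Q} {m m' : ℕ} (h : WeakStep N.Step τ (q, m) a (p, m'))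
    (k : ℕ) : WeakStep N.Step τ (q, m + k) a (p, m' + k) := by
  rcases h with ⟨h1, h2⟩ | ⟨u, v, h1, h2, h3⟩
  · exact Or.inl ⟨h1, N.tau_shift h2 k⟩
  · exact Or.inr ⟨_, _, N.tau_shift h1 k, Step.shift (N := N) h2 k, N.tau_shift h3 k⟩

theorem weak_pump [Fintype Q] {τ a : A} {q p : Q} {m m' : ℕ}
    (h : WeakStep N.Step τ (q, m) a (p, m')) (hm : m + (2 * Fintype.card Q + 1) ≤ m') (X : ℕ) :
    ∃ m'', X ≤ m'' ∧ WeakStep N.Step τ (q, m) a (p, m'') := by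
  rcases h with ⟨h1, h2⟩ | ⟨⟨u1, u2⟩, ⟨v1, v2⟩, h1, h2, h3⟩
  · obtain ⟨k, hk, h⟩ := N.tau_pump h2 (by omega) X
    exact ⟨_, by omega, Or.inl ⟨h1, h⟩⟩
  · have := Step.le h2
    simp only at this
    by_cases hu : m + Fintype.card Q ≤ u2
    · obtain ⟨k, hk, h⟩ := N.tau_pump h1 hu X
      exact ⟨_, by omega, Or.inr ⟨_, _, h, Step.shift h2 k, N.tau_shift h3 k⟩⟩
    · obtain ⟨k, hk, h⟩ := N.tau_pump h3 (by omega) X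
      exact ⟨_, by omega, Or.inr ⟨_, _, h1, h2, h⟩⟩

end OCN

theorem resp_class (rp : ℕ → ℕ → Prop) (hs : ∀ m m' k, rp m m' → rp (m + k) (m' + k)) (L : ℕ)
    (hp : ∀ m m', rp m m' → m + L ≤ m' → ∀ X, ∃ m'', X ≤ m'' ∧ rp m m'') :
    ∃ (K : ℕ) (om : Prop) (fe : ℤ → Prop) (B : ℤ),
      (∀ m m', rp m m' → om ∨ ∃ c, fe c ∧ (m' : ℤ) ≤ m + c) ∧
      (om → ∀ m, K ≤ m → ∀ X, ∃ m', X ≤ m' ∧ rp m m') ∧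
      (∀ c, fe c → ∀ m, K ≤ m → ∃ m' : ℕ, (m' : ℤ) = m + c ∧ rp m m') ∧
      (∀ c, fe c → |c| ≤ B) := by
  by_cases h1 : ∃ m m', rp m m' ∧ m + L ≤ m'
  · obtain ⟨m, m', h, hm⟩ := h1
    refine ⟨m, True, fun _ => False, 0, fun _ _ _ => Or.inl trivial, fun _ m1 hm1 X => ?_,
      fun _ h => h.elim, fun _ h => h.elim⟩
    obtain ⟨m'', h2, h3⟩ := hp m m' h hm X
    have := hs _ _ (m1 - m) h3
    rw [show m + (m1 - m) = m1 by omega] at this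
    exact ⟨_, by omega, this⟩
  push Not at h1
  by_cases h2 : ∃ m m', rp m m'
  · obtain ⟨m, m', h⟩ := h2
    obtain ⟨c, ⟨m0, m0', h3, h4⟩, hc⟩ := Int.exists_greatest_of_bdd
      (P := fun c => ∃ m m' : ℕ, rp m m' ∧ (m' : ℤ) - m = c)
      ⟨L, by rintro z ⟨m, m', h, rfl⟩; have := h1 m m' h; omega⟩ ⟨_, m, m', h, rfl⟩
    refine ⟨m0, False, fun x => x = c, |c|, fun m m' h => Or.inr ⟨c, rfl, ?_⟩, fun h => h.elim,
      ?_, ?_⟩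
    · have := hc _ ⟨m, m', h, rfl⟩; omega
    · rintro _ rfl m1 hm1
      have := hs _ _ (m1 - m0) h3
      rw [show m0 + (m1 - m0) = m1 by omega] at this
      exact ⟨_, by omega, this⟩
    · rintro _ rfl; exact le_rfl
  · push Not at h2
    exact ⟨0, False, fun _ => False, 0, fun m m' h => (h2 m m' h).elim, fun h => h.elim,
      fun _ h => h.elim, fun _ h => h.elim⟩

theorem weak_resp {Q A : Type} [Fintype Q] [Fintype A] (N : OCN Q A) (τ : A) :
    ∃ (K : ℕ) (om : A → Q → Q → Prop) (fe : A → Q → Q → ℤ → Prop) (L : ℤ), 1 ≤ L ∧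
      (∀ a q p m m', WeakStep N.Step τ (q, m) a (p, m') →
        om a q p ∨ ∃ c, fe a q p c ∧ (m' : ℤ) ≤ m + c) ∧
      (∀ a q p, om a q p → ∀ m, K ≤ m → ∀ X, ∃ m', X ≤ m' ∧ WeakStep N.Step τ (q, m) a (p, m')) ∧
      (∀ a q p c, fe a q p c → ∀ m, K ≤ m →
        ∃ m' : ℕ, (m' : ℤ) = m + c ∧ WeakStep N.Step τ (q, m) a (p, m')) ∧
      (∀ a q p c, fe a q p c → |c| ≤ L) := by
  have key := fun t : A × Q × Q => resp_class
    (fun m m' => WeakStep N.Step τ (t.2.1, m) t.1 (t.2.2, m'))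
    (fun m m' k h => N.weak_shift h k) _ (fun m m' h hm X => N.weak_pump h hm X)
  choose K om fe B h1 h2 h3 h4 using key
  obtain ⟨K0, hK0⟩ := (Set.finite_range K).bddAbove
  obtain ⟨B0, hB0⟩ := (Set.finite_range B).bddAbove
  have hK : ∀ t, K t ≤ K0 := fun t => hK0 ⟨t, rfl⟩
  have hB : ∀ t, B t ≤ B0 := fun t => hB0 ⟨t, rfl⟩
  exact ⟨K0, fun a q p => om (a, q, p), fun a q p => fe (a, q, p), max 1 B0, le_max_left _ _,
    fun a q p m m' h => h1 (a, q, p) m m' h,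
    fun a q p h m hm X => h2 (a, q, p) h m ((hK _).trans hm) X,
    fun a q p c h m hm => h3 (a, q, p) c h m ((hK _).trans hm),
    fun a q p c h => (h4 (a, q, p) c h).trans ((hB _).trans (le_max_right _ _))⟩

section Assembly
variable {Q Q' A : Type} (N : OCN Q A) (N' : OCN Q' A) (τ : A)

/-- The weak simulation preorder, indexed by pairs of control states. -/
def SS (v : Q × Q') (n m : ℕ) : Prop := WeakSimulates N.Step N'.Step τ (v.1, n) (v.2, m)

variable {N N' τ}

theorem SS_step {v : Q × Q'} {n m n' : ℕ} {a : A} {p : Q} (h : SS N N' τ v n m)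
    (hs : N.Step (v.1, n) a (p, n')) :
    ∃ p' m', WeakStep N'.Step τ (v.2, m) a (p', m') ∧ SS N N' τ (p, p') n' m' := by
  obtain ⟨R, hR, h⟩ := h
  obtain ⟨⟨p', m'⟩, h1, h2⟩ := hR _ _ h _ _ hs
  exact ⟨p', m', h1, R, hR, h2⟩

theorem SS_coind (T : Q × Q' → ℕ → ℕ → Prop)
    (hT : ∀ v n m, T v n m → ∀ a p n', N.Step (v.1, n) a (p, n') →
      ∃ p' m', WeakStep N'.Step τ (v.2, m) a (p', m') ∧
        (SS N N' τ (p, p') n' m' ∨ T (p, p') n' m')) {v : Q × Q'} {n m : ℕ} (h : T v n m) :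
    SS N N' τ v n m := by
  refine ⟨fun c c' => SS N N' τ (c.1, c'.1) c.2 c'.2 ∨ T (c.1, c'.1) c.2 c'.2, ?_, Or.inr h⟩
  rintro ⟨q, n⟩ ⟨q', m⟩ h a ⟨p, n'⟩ hs
  rcases h with h | h
  · obtain ⟨p', m', h1, h2⟩ := SS_step h hs
    exact ⟨(p', m'), h1, Or.inl h2⟩
  · obtain ⟨p', m', h1, h2⟩ := hT _ _ _ h a p n' hs
    exact ⟨(p', m'), h1, h2⟩

theorem SS_mono {v : Q × Q'} {n m n' m' : ℕ} (h : SS N N' τ v n m) (hn : n' ≤ n) (hm : m ≤ m') :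
    SS N N' τ v n' m' := by
  refine SS_coind (fun v n' m' => ∃ n m, n' ≤ n ∧ m ≤ m' ∧ SS N N' τ v n m) ?_ ⟨n, m, hn, hm, h⟩
  rintro v n' m' ⟨n, m, hn, hm, h⟩ a p k hs
  have hs' := OCN.Step.shift hs (n - n')
  rw [show n' + (n - n') = n by omega] at hs'
  obtain ⟨p', m1, h1, h2⟩ := SS_step h hs'
  have h1' := N'.weak_shift h1 (m' - m)
  rw [show m + (m' - m) = m' by omega] at h1'
  exact ⟨p', _, h1', Or.inr ⟨_, _, by omega, by omega, h2⟩⟩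

variable (N N' τ)

/-- The frontier function. -/
noncomputable def FF (v : Q × Q') (n : ℕ) : ℕ := sInf {m | SS N N' τ v n m}

/-- The frontier is everywhere finite. -/
def AllFin (v : Q × Q') : Prop := ∀ n, ∃ m, SS N N' τ v n m

variable {N N' τ}

theorem FF_le {v : Q × Q'} {n m : ℕ} (h : SS N N' τ v n m) : FF N N' τ v n ≤ m := Nat.sInf_le h

theorem FF_mem {v : Q × Q'} {n : ℕ} (h : ∃ m, SS N N' τ v n m) : SS N N' τ v n (FF N N' τ v n) :=
  Nat.sInf_mem h

theorem FF_iff {v : Q × Q'} {n m : ℕ} (h : AllFin N N' τ v) :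
    SS N N' τ v n m ↔ FF N N' τ v n ≤ m :=
  ⟨FF_le, fun hm => SS_mono (FF_mem (h n)) le_rfl hm⟩

theorem FF_mono {v : Q × Q'} {n n' : ℕ} (h : AllFin N N' τ v) (hn : n ≤ n') :
    FF N N' τ v n ≤ FF N N' τ v n' := FF_le (SS_mono (FF_mem (h n')) hn le_rfl)

theorem unif {ι : Type} [Finite ι] (P : ι → ℕ → Prop) (hP : ∀ i, ∃ x, ∀ y, x ≤ y → P i y) :
    ∃ x, ∀ i, ∀ y, x ≤ y → P i y := by
  choose x hx using hP
  obtain ⟨x0, h⟩ := (Set.finite_range x).bddAbove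
  exact ⟨x0, fun i y hy => hx i y ((h ⟨i, rfl⟩).trans hy)⟩

theorem FF_periodic [Fintype Q] [Fintype Q'] [Fintype A] {v : Q × Q'} (hv : AllFin N N' τ v)
    (hu : ∀ X, ∃ n, X ≤ FF N N' τ v n) :
    ∃ i a b : ℕ, 1 ≤ a ∧ ∀ n, i ≤ n → FF N N' τ v (n + a) = FF N N' τ v n + b := by
  obtain ⟨K0, om, fe, L, hL, r1, r2, r3, r4⟩ := weak_resp N' τ
  obtain ⟨c0, hc0⟩ := unif (fun (v : Q × Q') n => ¬ AllFin N N' τ v → ∀ m, ¬ SS N N' τ v n m) (by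
    intro v
    by_cases h : AllFin N N' τ v
    · exact ⟨0, fun _ _ h' => (h' h).elim⟩
    · have h' := h
      simp only [AllFin] at h'
      push Not at h'
      obtain ⟨n, hn⟩ := h'
      exact ⟨n, fun y hy _ m hm => hn m (SS_mono hm hy le_rfl)⟩)
  obtain ⟨B0, hB0⟩ := unif (fun (v : Q × Q') B => (¬ ∀ X, ∃ n, X ≤ FF N N' τ v n) →
      ∀ n, FF N N' τ v n ≤ B) (by
    intro v
    by_cases h : ∀ X, ∃ n, X ≤ FF N N' τ v n
    · exact ⟨0, fun _ _ h' => (h' h).elim⟩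
    · have h' := h
      push Not at h'
      obtain ⟨X, hX⟩ := h'
      exact ⟨X, fun y hy _ n => (hX n).le.trans hy⟩)
  obtain ⟨K, hK⟩ : ∃ K : ℕ, K = K0 + L.toNat + B0 := ⟨_, rfl⟩
  obtain ⟨x0, hx0⟩ := unif (fun (v : Q × Q') n => AllFin N N' τ v →
      (∀ X, ∃ n, X ≤ FF N N' τ v n) → K ≤ FF N N' τ v n) (by
    intro v
    by_cases h : AllFin N N' τ v ∧ ∀ X, ∃ n, X ≤ FF N N' τ v n
    · obtain ⟨n, hn⟩ := h.2 K
      exact ⟨n, fun y hy h1 _ => hn.trans (FF_mono h1 hy)⟩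
    · exact ⟨0, fun _ _ h1 h2 => (h ⟨h1, h2⟩).elim⟩)
  obtain ⟨n1, hn1⟩ : ∃ n1 : ℕ, n1 = c0 + x0 + 1 := ⟨_, rfl⟩
  let Y : Q × Q' → Prop := fun v => AllFin N N' τ v ∧ ∀ X, ∃ n, X ≤ FF N N' τ v n
  let Imm : Q × Q' → A × ℤ × Q → Prop := fun v i => ∃ p', AllFin N N' τ (i.2.2, p') ∧
    (om i.1 v.2 p' ∨ (¬ (∀ X, ∃ n, X ≤ FF N N' τ (i.2.2, p') n) ∧ ∃ c, fe i.1 v.2 p' c))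
  let G : Arena {v // Y v} (A × ℤ × Q) :=
    { Mov := fun v i => N.δ v.1.1 i.1 i.2.1 i.2.2 ∧ ¬ Imm v.1 i
      dd := fun i => i.2.1
      R := fun v i w c => w.1.1 = i.2.2 ∧ fe i.1 v.1.2 w.1.2 c
      f := fun v n => (FF N N' τ v.1 n.toNat : ℤ)
      L := L
      K := K
      n1 := n1
      hL := hL
      hK := by positivity
      hn1 := by positivity
      hdd := by
        rintro v i ⟨h, -⟩
        rcases N.effect_bounded _ _ _ _ h with h | h | h <;> simp [h]
      hR := by
        rintro v i w c ⟨-, h⟩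
        exact r4 _ _ _ _ h
      low := by
        intro v n hn
        have := hx0 v.1 n.toNat (by omega) v.2.1 v.2.2
        exact_mod_cast this
      step := by
        rintro ⟨v, hv⟩ n m hn hm hf ⟨a, d, p⟩ ⟨hmov, himm⟩
        lift n to ℕ using by omega
        lift m to ℕ using by omega
        simp only [Int.toNat_natCast] at hf hmov himm ⊢
        have hS : SS N N' τ v n m := (FF_iff hv.1).2 (by exact_mod_cast hf)
        have hd := N.effect_bounded _ _ _ _ hmov
        have hst : N.Step (v.1, n) a (p, ((n : ℤ) + d).toNat) := ⟨d, hmov, by simp only; omega⟩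
        obtain ⟨p', m', h1, h2⟩ := SS_step hS hst
        have hfin : AllFin N N' τ (p, p') := by
          by_contra hcon
          exact hc0 _ ((n : ℤ) + d).toNat (by omega) hcon _ h2
        rcases r1 _ _ _ _ _ h1 with ho | ⟨c, hc, hle⟩
        · exact (himm ⟨p', hfin, Or.inl ho⟩).elim
        · by_cases hY : ∀ X, ∃ n, X ≤ FF N N' τ (p, p') n
          · refine ⟨⟨(p, p'), hfin, hY⟩, c, ⟨rfl, hc⟩, ?_⟩
            have := FF_le h2
            refine le_trans ?_ hle
            exact_mod_cast this
          · exact (himm ⟨p', hfin, Or.inr ⟨hY, c, hc⟩⟩).elim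
      coind := by
        intro T hT v n m h
        have h0 := hT v n m h
        lift n to ℕ using by omega
        lift m to ℕ using by omega
        have : SS N N' τ v.1 n m := by
          refine SS_coind (fun v n m => ∃ hv : Y v, T ⟨v, hv⟩ n m) ?_ ⟨v.2, h⟩
          rintro v n m ⟨hv, h⟩ a p n' ⟨d, hd, hn'⟩
          obtain ⟨g1, g2, g3⟩ := hT _ _ _ h
          simp only at hn' hd
          by_cases himm : Imm v (a, d, p)
          · obtain ⟨p', hfin, ho | ⟨hb, c, hc⟩⟩ := himm
            · obtain ⟨m', h1, h2⟩ := r2 a v.2 p' ho m (by omega) (FF N N' τ (p, p') n')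
              exact ⟨p', m', h2, Or.inl ((FF_iff hfin).2 h1)⟩
            · obtain ⟨m', h1, h2⟩ := r3 a v.2 p' c hc m (by omega)
              have h4 := abs_le.1 (r4 _ _ _ _ hc)
              refine ⟨p', m', h2, Or.inl ((FF_iff hfin).2 ((hB0 _ B0 le_rfl hb n').trans ?_))⟩
              omega
          · obtain ⟨⟨w, hw⟩, c, ⟨e, hc⟩, h5⟩ := g3 (a, d, p) ⟨hd, himm⟩
            simp only at e hc h5
            obtain ⟨w1, w2⟩ := w
            simp only at e hc
            subst e
            obtain ⟨m', h1, h2⟩ := r3 a v.2 w2 c hc m (by omega)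
            rw [← hn', ← h1] at h5
            refine ⟨w2, m', h2, ?_⟩
            rcases h5 with h5 | h5
            · exact Or.inr ⟨hw, h5⟩
            · left
              rw [FF_iff hw.1]
              simp only [Int.toNat_natCast] at h5
              exact_mod_cast h5
        have := FF_le this
        simpa using this }
  haveI : Fintype {v // Y v} := Fintype.ofFinite _
  have hunb : ∀ v X, ∃ n, G.n1 ≤ n ∧ X ≤ G.f v n := by
    intro v X
    obtain ⟨n, hn⟩ := v.2.2 X.toNat
    refine ⟨((n + n1 : ℕ) : ℤ), by change (n1 : ℤ) ≤ _; push_cast; omega, ?_⟩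
    change X ≤ (FF N N' τ v.1 ((n + n1 : ℕ) : ℤ).toNat : ℤ)
    have := FF_mono v.2.1 (show n ≤ n + n1 by omega)
    simp only [Int.toNat_natCast]
    omega
  obtain ⟨i, a, b, h1, h2, h3⟩ := G.periodic hunb ⟨v, hv, hu⟩
  change (n1 : ℤ) ≤ i at h1
  have h3' : ∀ n : ℕ, i ≤ n → (FF N N' τ v (n + a.toNat) : ℤ) = FF N N' τ v n + b := by
    intro n hn
    have : (FF N N' τ v ((n : ℤ) + a).toNat : ℤ) = FF N N' τ v (n : ℤ).toNat + b := h3 n hn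
    rw [show ((n : ℤ) + a).toNat = n + a.toNat by omega] at this
    simpa using this
  refine ⟨i.toNat, a.toNat, b.toNat, by omega, fun n hn => ?_⟩
  have e := h3' n (by omega)
  have := FF_mono hv (show n ≤ n + a.toNat by omega)
  omega

theorem FF_periodic' [Fintype Q] [Fintype Q'] [Fintype A] {v : Q × Q'} (hv : AllFin N N' τ v) :
    ∃ i a b : ℕ, 1 ≤ a ∧ ∀ n, i ≤ n → FF N N' τ v (n + a) = FF N N' τ v n + b := by
  by_cases hu : ∀ X, ∃ n, X ≤ FF N N' τ v n
  · exact FF_periodic hv hu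
  push Not at hu
  obtain ⟨X, hX⟩ := hu
  obtain ⟨c, ⟨n, hn⟩, hc⟩ := Int.exists_greatest_of_bdd
      (P := fun c => ∃ n : ℕ, (FF N N' τ v n : ℤ) = c)
      ⟨X, by rintro z ⟨n, rfl⟩; exact_mod_cast (hX n).le⟩ ⟨_, 0, rfl⟩
  have key : ∀ k, n ≤ k → (FF N N' τ v k : ℤ) = c := by
    intro k hk
    have h1 := hc _ ⟨k, rfl⟩
    have h2 := FF_mono hv hk
    omega
  refine ⟨n, 1, 0, le_rfl, fun k hk => ?_⟩
  have := key k hk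
  have := key (k + 1) (by omega)
  omega

end Assembly

theorem semilinear_of_finite {ι : Type} [Finite ι] (f : ι → Set (ℕ × ℕ))
    (hf : ∀ i, IsLinearSubset (f i)) : IsSemilinearSubset (⋃ i, f i) := by
  obtain ⟨n, ⟨e⟩⟩ := Finite.exists_equiv_fin ι
  refine ⟨n, fun i => f (e.symm i), fun i => hf _, ?_⟩
  exact (e.symm.surjective.iUnion_comp f).symm

theorem linear_two (x y a b : ℕ) (ha : 1 ≤ a) :
    IsLinearSubset {z | ∃ s t : ℕ, z = (x + s * a, y + s * b + t)} := by
  refine ⟨(x, y), {(a, b), (0, 1)}, ?_⟩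
  have hne : (a, b) ≠ ((0, 1) : ℕ × ℕ) := by
    intro h
    have := congrArg Prod.fst h
    simp only at this
    omega
  ext z
  simp only [Set.mem_setOf_eq, Finset.sum_pair hne]
  constructor
  · rintro ⟨s, t, rfl⟩
    refine ⟨fun p => if p = (a, b) then s else t, ?_⟩
    simp [hne.symm]
    omega
  · rintro ⟨c, rfl⟩
    refine ⟨c (a, b), c (0, 1), ?_⟩
    simp
    omega

theorem linear_one (x y : ℕ) : IsLinearSubset {z | ∃ t : ℕ, z = (x, y + t)} := by
  refine ⟨(x, y), {(0, 1)}, ?_⟩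
  ext z
  simp only [Set.mem_setOf_eq, Finset.sum_singleton]
  constructor
  · rintro ⟨t, rfl⟩
    exact ⟨fun _ => t, by simp⟩
  · rintro ⟨c, rfl⟩
    exact ⟨c (0, 1), by simp⟩

/-- For any two one-counter nets `N` and `N'` (with
internal action `τ`), the largest weak simulation relation `⪯w` is
semilinear: for every pair `(q, q')` of control states, the set
`{(n, n') ∈ ℕ² : qn ⪯w q'n'}` is a finite union of linear sets. -/
theorem weak_sim_semilinear {Q Q' A : Type} [Fintype Q] [Fintype Q'] [Fintype A]
    (N : OCN Q A) (N' : OCN Q' A) (τ : A) (q : Q) (q' : Q') :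
    IsSemilinearSubset {x : ℕ × ℕ | WeakSimulates N.Step N'.Step τ (q, x.1) (q', x.2)} := by
  change IsSemilinearSubset {x : ℕ × ℕ | SS N N' τ (q, q') x.1 x.2}
  by_cases hv : AllFin N N' τ (q, q')
  · obtain ⟨i, a, b, ha, h⟩ := FF_periodic' hv
    have hall : ∀ s n, i ≤ n →
        FF N N' τ (q, q') (n + s * a) = FF N N' τ (q, q') n + s * b := by
      intro s n hn
      induction s with
      | zero => simp
      | succ s ih =>
        have := h (n + s * a) (by omega)
        rw [show n + (s + 1) * a = n + s * a + a by ring, this, ih]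
        ring
    have := semilinear_of_finite (ι := Fin i ⊕ Fin a) (Sum.elim
      (fun k => {z | ∃ t : ℕ, z = ((k : ℕ), FF N N' τ (q, q') k + t)})
      (fun k => {z | ∃ s t : ℕ, z = (i + k + s * a, FF N N' τ (q, q') (i + k) + s * b + t)}))
      (by
        rintro (k | k)
        · exact linear_one _ _
        · exact linear_two _ _ _ _ ha)
    convert this using 1
    ext ⟨n, m⟩
    simp only [Set.mem_setOf_eq, Set.mem_iUnion, Sum.exists, Sum.elim_inl, Sum.elim_inr,
      FF_iff hv, Prod.mk.injEq]
    constructor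
    · intro hm
      by_cases hn : n < i
      · exact Or.inl ⟨⟨n, hn⟩, m - FF N N' τ (q, q') n, rfl, by simp only; omega⟩
      · right
        have e : i + (n - i) % a + (n - i) / a * a = n := by
          have := Nat.mod_add_div' (n - i) a
          omega
        refine ⟨⟨(n - i) % a, Nat.mod_lt _ ha⟩, (n - i) / a, m - FF N N' τ (q, q') n, e.symm, ?_⟩
        simp only
        rw [← hall _ _ (by omega), e]
        omega
    · rintro (⟨k, t, rfl, rfl⟩ | ⟨k, s, t, rfl, rfl⟩)
      · omega
      · rw [hall _ _ (by omega)]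
        omega
  · have h' := hv
    simp only [AllFin] at h'
    push Not at h'
    obtain ⟨c, hc⟩ := h'
    have := semilinear_of_finite
      (ι := {k : Fin c // ∃ m, SS N N' τ (q, q') k m})
      (fun k => {z | ∃ t : ℕ, z = ((k.1 : ℕ), FF N N' τ (q, q') k.1 + t)})
      (fun k => linear_one _ _)
    convert this using 1
    ext ⟨n, m⟩
    simp only [Set.mem_setOf_eq, Set.mem_iUnion, Prod.mk.injEq]
    constructor
    · intro hm
      have hn : n < c := by
        by_contra hcon
        exact hc m (SS_mono hm (by omega) le_rfl)
      have := FF_le hm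
      exact ⟨⟨⟨n, hn⟩, m, hm⟩, m - FF N N' τ (q, q') n, rfl, by simp only; omega⟩
    · rintro ⟨k, t, rfl, rfl⟩
      exact SS_mono (FF_mem k.2) le_rfl (by omega)
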